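/- Lemma 2: for any history H, any labs l, l' ∈ {1,…,N} whose triples occur in H, and any times t, t' ∈ {1,…,T}, the inner product ⟨φ̄_{(l',t',H)} | φ̄_{(l,t,H)}⟩ = 0 unless l = l' and t = t'. -/

import Mathlib

noncomputable section

/-!
Shared framework: quantum protocols with a quantum control of causal order,
following Purves & Short, "Quantum theory cannot violate a causal inequality".

The total Hilbert space `H_s ⊗ H_c ⊗ (⊗ᵢ H_{rᵢ}) ⊗ (⊗ᵢ H_{fᵢ})` is modelled
concretely as `ℓ²` of the finite basis-index set
`Idx = S × Fin (N+1) × (Π i, A i) × (Π i, Fin (T+1))`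
(system basis, control basis |0⟩,…,|N⟩, result-register bases, flag bases),
vectors being functions `Idx → ℂ`, operators being matrices.
-/

namespace CIQ

variable {N T : ℕ} {S : Type} [Fintype S] [DecidableEq S]
variable {A : Fin N → Type} [∀ i, Fintype (A i)] [∀ i, DecidableEq (A i)]
variable {X : Fin N → Type} [∀ i, Fintype (X i)] [∀ i, DecidableEq (X i)]

/-- Basis index set of the total Hilbert space: system × control × results × flags. -/
abbrev Idx (N T : ℕ) (S : Type) (A : Fin N → Type) : Type :=
  S × Fin (N + 1) × ((i : Fin N) → A i) × ((i : Fin N) → Fin (T + 1))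

/-- A history: an ordered list of triples (lab, outcome, setting). -/
abbrev Hist (N : ℕ) (A X : Fin N → Type) : Type := List ((l : Fin N) × (A l × X l))

/-- The labs occurring in a history are pairwise distinct. -/
def labsDistinct (H : Hist N A X) : Prop := (H.map Sigma.fst).Nodup

/-- Squared ℓ²-norm ‖v‖². -/
def nsq (v : Idx N T S A → ℂ) : ℝ := ∑ p, Complex.normSq (v p)

/-- The ℓ² inner product ⟨v|w⟩ (conjugate-linear in the first argument). -/
def hinner (v w : Idx N T S A → ℂ) : ℂ := ∑ p, (starRingEnd ℂ) (v p) * w p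

/-- The data of a quantum protocol: a distinguished initial system basis state `s0`,
initial result-register states `r0`, measurement unitaries `Vm l x` on `H_s ⊗ H_{r_l}`
for each lab and setting, and inter-step unitaries `U t` on `H_s ⊗ H_c` (for `1 ≤ t ≤ T`). -/
structure Protocol (N T : ℕ) (S : Type) (A X : Fin N → Type) where
  s0 : S
  r0 : ∀ i, A i
  Vm : (l : Fin N) → X l → Matrix (S × A l) (S × A l) ℂ
  U : ℕ → Matrix (S × Fin (N + 1)) (S × Fin (N + 1)) ℂ

/-- Extension of an operator on `H_s ⊗ H_c` by the identity on results and flags. -/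
def extSC (M : Matrix (S × Fin (N + 1)) (S × Fin (N + 1)) ℂ) :
    Matrix (Idx N T S A) (Idx N T S A) ℂ := fun p q =>
  if p.2.2 = q.2.2 then M (p.1, p.2.1) (q.1, q.2.1) else 0

namespace Protocol

variable (P : Protocol N T S A X) (x : ∀ l, X l)

/-- Each measurement unitary is indeed unitary. -/
def unitaryVm : Prop := ∀ (l : Fin N) (xv : X l), P.Vm l xv ∈ Matrix.unitaryGroup (S × A l) ℂ

/-- Each inter-step unitary `U t`, `1 ≤ t ≤ T`, is indeed unitary. -/
def unitaryU : Prop :=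
  ∀ t : ℕ, 1 ≤ t → t ≤ T → P.U t ∈ Matrix.unitaryGroup (S × Fin (N + 1)) ℂ

/-- The initial state |0⟩ = |0⟩_s |0⟩_c |0⟩_r^N |0⟩_f^N. -/
def ket0 : Idx N T S A → ℂ :=
  fun p => if p = (P.s0, 0, P.r0, fun _ => 0) then 1 else 0

/-- The lab-activation unitary
`V = |0⟩⟨0|_c ⊗ I + Σ_{l=1}^N |l⟩⟨l|_c ⊗ V_{s,r_l}(x_l) ⊗ Γ_{f_l} ⊗ I`,
where `Γ` is the cyclic shift raising the flag. -/
def Vmat : Matrix (Idx N T S A) (Idx N T S A) ℂ := fun p q =>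
  if h : p.2.1 = (0 : Fin (N + 1)) then (if q = p then 1 else 0)
  else
    if q.2.1 = p.2.1 ∧ (∀ i, i ≠ p.2.1.pred h → q.2.2.1 i = p.2.2.1 i)
        ∧ (∀ i, i ≠ p.2.1.pred h → q.2.2.2 i = p.2.2.2 i)
        ∧ q.2.2.2 (p.2.1.pred h) + 1 = p.2.2.2 (p.2.1.pred h) then
      P.Vm (p.2.1.pred h) (x (p.2.1.pred h))
        (p.1, p.2.2.1 (p.2.1.pred h)) (q.1, q.2.2.1 (p.2.1.pred h))
    else 0

/-- `chain t = V U_t V U_{t-1} ⋯ V U_1`. -/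
def chain : ℕ → Matrix (Idx N T S A) (Idx N T S A) ℂ
  | 0 => 1
  | t + 1 => P.Vmat x * (extSC (P.U (t + 1)) * chain t)

/-- `pre t = U_t V U_{t-1} ⋯ V U_1` (the evolution just before the `t`-th activation). -/
def pre (t : ℕ) : Matrix (Idx N T S A) (Idx N T S A) ℂ :=
  extSC (P.U t) * P.chain x (t - 1)

/-- The total unitary `𝒰 = V U_T V U_{T-1} ⋯ V U_1`. -/
def Uop : Matrix (Idx N T S A) (Idx N T S A) ℂ := P.chain x T

/-- `tailPhi k = V U_T V U_{T-1} ⋯ U_{T-k+1}` (evolution to the end of the protocol,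
starting just after the `(T-k)`-th activation); `k` counts remaining time steps. -/
def tailPhi : ℕ → Matrix (Idx N T S A) (Idx N T S A) ℂ
  | 0 => 1
  | k + 1 => tailPhi k * (P.Vmat x * extSC (P.U (T - k)))

end Protocol

/-- The condition imposed by the projector `π^H_{rf}`: result registers of labs in the
history `H` show the recorded outcomes and their flags are raised (to `1`), while the
flags of all other labs read `0`. -/
def histSat (H : Hist N A X) (rr : ∀ i, A i) (ff : (i : Fin N) → Fin (T + 1)) : Prop :=
  (∀ e ∈ H, rr e.1 = e.2.1 ∧ ff e.1 = 1) ∧ (∀ i : Fin N, (∀ e ∈ H, e.1 ≠ i) → ff i = 0)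

instance (H : Hist N A X) (rr : ∀ i, A i) (ff : (i : Fin N) → Fin (T + 1)) :
    Decidable (histSat H rr ff) := by
  unfold histSat; infer_instance

namespace Protocol

variable (P : Protocol N T S A X) (x : ∀ l, X l)

/-- `|ψ_{(l,t,H)}⟩ = (|l⟩⟨l|_c ⊗ π^H_{rf} ⊗ I_s) U_t V U_{t-1} ⋯ V U_1 |0⟩`,
where the control value `l ∈ {0,1,…,N}`. -/
def psi (l : Fin (N + 1)) (t : ℕ) (H : Hist N A X) : Idx N T S A → ℂ := fun p =>
  if p.2.1 = l ∧ histSat H p.2.2.1 p.2.2.2 then (P.pre x t).mulVec (P.ket0) p else 0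

/-- `|ψ̄_{(l,t,H)}⟩ = V U_T V U_{T-1} ⋯ U_{t+1} V |ψ_{(l,t,H)}⟩`. -/
def psibar (l : Fin (N + 1)) (t : ℕ) (H : Hist N A X) : Idx N T S A → ℂ :=
  (P.tailPhi x (T - t) * P.Vmat x).mulVec (P.psi x l t H)

/-- The just-measured state with previous history `H`:
`(|a⟩⟨a|_{r_l} ⊗ I) V |ψ_{(l,t,H)}⟩` (control value `l` among `1,…,N`). -/
def phiOf (l : Fin N) (a : A l) (t : ℕ) (H : Hist N A X) : Idx N T S A → ℂ := fun p =>
  if p.2.2.1 l = a then (P.Vmat x).mulVec (P.psi x l.succ t H) p else 0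

/-- `|φ_{(l,t,H)}⟩` for a lab `l` whose triple `(l, a, x_l)` occurs in the history `H`:
`(|a⟩⟨a|_{r_l} ⊗ I) V |ψ_{(l,t,H∖(l,a,x_l))}⟩`. -/
def phiFull (l : Fin N) (a : A l) (t : ℕ) (H : Hist N A X) : Idx N T S A → ℂ :=
  P.phiOf x l a t (H.filter fun e => decide (e.1 ≠ l))

/-- `|φ̄_{(l,t,H)}⟩ = V U_T V ⋯ U_{t+1} |φ_{(l,t,H)}⟩`. -/
def phibar (l : Fin N) (a : A l) (t : ℕ) (H : Hist N A X) : Idx N T S A → ℂ :=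
  (P.tailPhi x (T - t)).mulVec (P.phiFull x l a t H)

/-- `|φ_{(0,t,H)}⟩ = V |ψ_{(0,t,H)}⟩`. -/
def phi0 (t : ℕ) (H : Hist N A X) : Idx N T S A → ℂ :=
  (P.Vmat x).mulVec (P.psi x 0 t H)

/-- `|φ̄_{(0,t,H)}⟩ = V U_T V ⋯ U_{t+1} |φ_{(0,t,H)}⟩`. -/
def phibar0 (t : ℕ) (H : Hist N A X) : Idx N T S A → ℂ :=
  (P.tailPhi x (T - t)).mulVec (P.phi0 x t H)

/-- `Σ_{t=1}^T ‖ψ_{(l,t,H)}‖²` (numerator of Definition 4). -/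
def numPsi (H : Hist N A X) (l : Fin N) : ℝ :=
  ∑ t ∈ Finset.Icc 1 T, nsq (P.psi x l.succ t H)

/-- `Σ_{l'∉ℒ} Σ_{t=1}^T ‖ψ_{(l',t,H)}‖²` (denominator of Definition 4). -/
def denPsi (H : Hist N A X) : ℝ :=
  ∑ l ∈ Finset.univ.filter (fun l : Fin N => ∀ e ∈ H, e.1 ≠ l), P.numPsi x H l

/-- Definition 4: `p_k(l_k|H_{k-1})`, the probability for lab `l` to act next. -/
def pNext (H : Hist N A X) (l : Fin N) : ℝ := P.numPsi x H l / P.denPsi x H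

/-- `Σ_{t=1}^T ‖φ_{(l,t,(H,(l,a,x_l)))}‖²` (numerator of Definition 5). -/
def numPhi (H : Hist N A X) (l : Fin N) (a : A l) : ℝ :=
  ∑ t ∈ Finset.Icc 1 T, nsq (P.phiOf x l a t H)

/-- Definition 5: `p_k(a|H_{k-1},x_l)`, the probability for lab `l`, acting next after
history `H` with its setting `x l`, to obtain outcome `a`. -/
def pOut (H : Hist N A X) (l : Fin N) (a : A l) : ℝ :=
  P.numPhi x H l a / ∑ a' : A l, P.numPhi x H l a'

/-- The quantum outcome distribution
`p^quantum(a⃗|x⃗) = ‖(|a⃗⟩⟨a⃗|_r ⊗ I) 𝒰 |0⟩‖²`. -/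
def pQ (a : ∀ i, A i) : ℝ :=
  nsq (fun p => if p.2.2.1 = a then (P.Uop x).mulVec P.ket0 p else 0)

/-- The flag constraint: at the end of the protocol every flag reads `1`
(each party has interacted with the system exactly once). -/
def flagOK : Prop :=
  ∀ p : Idx N T S A, (P.Uop x).mulVec P.ket0 p ≠ 0 → ∀ i, p.2.2.2 i = 1

end Protocol

/-- The causal-model expression of Definition 1, written recursively:
`causalSum q o x a k H` sums over the next `k` parties to act (those not in `H`),
multiplying the 'who is next?' probabilities `q` and the 'what did they see?'
probabilities `o`, with the history extended accordingly.  The full expression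
of Definition 1 is `causalSum q o x a N []`. -/
def causalSum (q : Hist N A X → Fin N → ℝ)
    (o : Hist N A X → (l : Fin N) → X l → A l → ℝ)
    (x : ∀ i, X i) (a : ∀ i, A i) : ℕ → Hist N A X → ℝ
  | 0, _ => 1
  | k + 1, H =>
      ∑ l : Fin N,
        if ∀ e ∈ H, e.1 ≠ l then
          q H l * o H l (x l) (a l) * causalSum q o x a k (H ++ [⟨l, (a l, x l)⟩])
        else 0

end CIQ

end


open CIQ CIQ.Protocol

namespace CIQ

set_option linter.unusedSectionVars false

section Aux

variable {N T : ℕ} {S : Type} [Fintype S] [DecidableEq S]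
variable {A : Fin N → Type} [∀ i, Fintype (A i)] [∀ i, DecidableEq (A i)]
variable {X : Fin N → Type}

lemma exists_of_mulVec_ne_zero {m n : Type*} [Fintype n] {M : Matrix m n ℂ} {v : n → ℂ} {p : m}
    (h : M.mulVec v p ≠ 0) : ∃ q, M p q ≠ 0 ∧ v q ≠ 0 := by
  obtain ⟨q, -, hq⟩ := Finset.exists_ne_zero_of_sum_ne_zero h
  exact ⟨q, left_ne_zero_of_mul hq, right_ne_zero_of_mul hq⟩

lemma hinner_eq_dotProduct (v w : Idx N T S A → ℂ) : hinner v w = star v ⬝ᵥ w := rfl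

lemma hinner_mulVec_of_unitary {M : Matrix (Idx N T S A) (Idx N T S A) ℂ}
    (hM : M ∈ Matrix.unitaryGroup (Idx N T S A) ℂ) (v w : Idx N T S A → ℂ) :
    hinner (M.mulVec v) (M.mulVec w) = hinner v w := by
  rw [hinner_eq_dotProduct, hinner_eq_dotProduct, Matrix.star_mulVec, ← Matrix.dotProduct_mulVec,
    Matrix.mulVec_mulVec, ← Matrix.star_eq_conjTranspose, Matrix.mem_unitaryGroup_iff'.mp hM,
    Matrix.one_mulVec]

lemma hinner_eq_zero_symm {v w : Idx N T S A → ℂ} (h : hinner v w = 0) : hinner w v = 0 := by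
  have : hinner w v = (starRingEnd ℂ) (hinner v w) := by
    simp [hinner, map_sum, mul_comm]
  rw [this, h, map_zero]

lemma hinner_eq_zero_of_disjoint {v w : Idx N T S A → ℂ} (h : ∀ p, v p ≠ 0 → w p ≠ 0 → False) :
    hinner v w = 0 := by
  refine Finset.sum_eq_zero fun p _ => ?_
  by_cases hv : v p = 0
  · simp [hv]
  · by_cases hw : w p = 0
    · simp [hw]
    · exact (h p hv hw).elim

lemma extSC_eq_of_ne_zero {M : Matrix (S × Fin (N + 1)) (S × Fin (N + 1)) ℂ} {p q : Idx N T S A}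
    (h : extSC M p q ≠ 0) : p.2.2 = q.2.2 := by
  by_contra hne
  exact h (if_neg hne)

lemma extSC_mem_unitaryGroup {M : Matrix (S × Fin (N + 1)) (S × Fin (N + 1)) ℂ}
    (hM : M ∈ Matrix.unitaryGroup (S × Fin (N + 1)) ℂ) :
    (extSC M : Matrix (Idx N T S A) (Idx N T S A) ℂ) ∈ Matrix.unitaryGroup (Idx N T S A) ℂ := by
  rw [Matrix.mem_unitaryGroup_iff] at hM ⊢
  ext ⟨s, c, z⟩ ⟨s', c', z'⟩
  have h := congrFun (congrFun hM (s, c)) (s', c')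
  simp only [Matrix.mul_apply, Matrix.star_apply, Matrix.one_apply, Fintype.sum_prod_type,
    Prod.mk.injEq] at h
  rw [Matrix.mul_apply, Matrix.one_apply, Fintype.sum_prod_type]
  simp only [Fintype.sum_prod_type (α₁ := Fin (N + 1)), Matrix.star_apply, extSC, ite_mul, zero_mul,
    Finset.sum_ite_eq, Finset.mem_univ, if_true]
  by_cases hz : z' = z
  · subst hz
    simpa using h
  · simp [hz, Ne.symm hz]

variable (P : Protocol N T S A X) (x : ∀ l, X l)

lemma Vmat_zero (s : S) (z : ((i : Fin N) → A i) × ((i : Fin N) → Fin (T + 1)))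
    (q : Idx N T S A) : P.Vmat x (s, 0, z) q = if q = (s, 0, z) then 1 else 0 := by
  simp [Vmat]

lemma Vmat_succ (s : S) (l : Fin N) (r : ∀ i, A i) (f : (i : Fin N) → Fin (T + 1))
    (q : Idx N T S A) : P.Vmat x (s, l.succ, r, f) q =
      if q.2.1 = l.succ ∧ (∀ i, i ≠ l → q.2.2.1 i = r i) ∧ (∀ i, i ≠ l → q.2.2.2 i = f i)
        ∧ q.2.2.2 l + 1 = f l then P.Vm l (x l) (s, r l) (q.1, q.2.2.1 l) else 0 := by
  simp [Vmat, Fin.succ_ne_zero]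
  rfl

lemma Vmat_support {p q : Idx N T S A} (h : P.Vmat x p q ≠ 0) :
    q.2.1 = p.2.1 ∧ (∀ l : Fin N, p.2.1 ≠ l.succ → q.2.2.2 l = p.2.2.2 l) ∧
      (∀ l : Fin N, p.2.1 = l.succ → q.2.2.2 l + 1 = p.2.2.2 l) := by
  obtain ⟨s, c, r, f⟩ := p
  induction c using Fin.cases with
  | zero =>
    rw [Vmat_zero] at h
    have hq : q = (s, 0, r, f) := by
      by_contra hne
      exact h (if_neg hne)
    subst hq
    exact ⟨rfl, fun _ _ => rfl, fun l hl => (Fin.succ_ne_zero l hl.symm).elim⟩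
  | succ k =>
    rw [Vmat_succ] at h
    have hq := (ite_ne_right_iff.mp h).1
    refine ⟨hq.1, fun l hl => hq.2.2.1 l fun e => hl (by rw [e]), fun l hl => ?_⟩
    obtain rfl := Fin.succ_injective _ hl
    exact hq.2.2.2

lemma sum_Vmat_succ_mul (s : S) (l : Fin N) (r : ∀ i, A i) (f : (i : Fin N) → Fin (T + 1))
    (g : Idx N T S A → ℂ) : ∑ q, P.Vmat x (s, l.succ, r, f) q * g q =
      ∑ y : S × A l, P.Vm l (x l) (s, r l) y *
        g (y.1, l.succ, Function.update r l y.2, Function.update f l (f l - 1)) := by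
  symm
  refine Finset.sum_of_injOn
    (fun y => (y.1, l.succ, Function.update r l y.2, Function.update f l (f l - 1))) ?_ ?_ ?_ ?_
  · rintro ⟨s₁, a₁⟩ - ⟨s₂, a₂⟩ - h
    simp only [Prod.mk.injEq, true_and, and_true] at h
    exact Prod.ext h.1 (Function.update_injective r l h.2)
  · simp
  · rintro ⟨s', c, r', f'⟩ - hq
    rw [Vmat_succ, if_neg, zero_mul]
    rintro ⟨hc, hr, hf, hl⟩
    refine hq ⟨(s', r' l), by simp, ?_⟩
    simp only at hc hr hf hl
    have h1 : Function.update r l (r' l) = r' := by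
      rw [Function.update_eq_iff]
      exact ⟨rfl, fun i hi => (hr i hi).symm⟩
    have h2 : Function.update f l (f l - 1) = f' := by
      rw [Function.update_eq_iff]
      exact ⟨by rw [← hl, add_sub_cancel_right], fun i hi => (hf i hi).symm⟩
    simp only [h1, h2, hc]
  · rintro ⟨s', a⟩ -
    rw [Vmat_succ, if_pos]
    · simp
    · refine ⟨rfl, fun i hi => ?_, fun i hi => ?_, ?_⟩ <;> simp [*]

lemma Vmat_mem_unitaryGroup (hVm : P.unitaryVm) :
    P.Vmat x ∈ Matrix.unitaryGroup (Idx N T S A) ℂ := by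
  rw [Matrix.mem_unitaryGroup_iff]
  ext ⟨s, c, r, f⟩ p'
  rw [Matrix.mul_apply]
  simp only [Matrix.star_apply]
  induction c using Fin.cases with
  | zero =>
    simp only [Vmat_zero, ite_mul, one_mul, zero_mul, Finset.sum_ite_eq', Finset.mem_univ, if_true]
    obtain ⟨s', c', r', f'⟩ := p'
    induction c' using Fin.cases with
    | zero => rw [Vmat_zero, Matrix.one_apply]; split_ifs <;> simp
    | succ k =>
      rw [Vmat_succ, if_neg, Matrix.one_apply, if_neg, star_zero]
      · simp [(Fin.succ_ne_zero k).symm]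
      · exact fun h => (Fin.succ_ne_zero k) h.1.symm
  | succ l =>
    rw [sum_Vmat_succ_mul P x s l r f (fun q => star (P.Vmat x p' q))]
    by_cases hc : p'.2.1 = l.succ ∧ (∀ i, i ≠ l → p'.2.2.1 i = r i) ∧ p'.2.2.2 = f
    · obtain ⟨s', c', r', f'⟩ := p'
      obtain ⟨h1, h2, h3⟩ := hc
      simp only at h1 h2 h3
      subst h1 h3
      have key : ∀ y : S × A l, P.Vmat x (s', l.succ, r', f')
          (y.1, l.succ, Function.update r l y.2, Function.update f' l (f' l - 1))
            = P.Vm l (x l) (s', r' l) y := by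
        intro y
        rw [Vmat_succ, if_pos]
        · simp
        · refine ⟨rfl, fun i hi => ?_, fun i hi => ?_, ?_⟩ <;> simp [*]
      have h := congrFun (congrFun (Matrix.mem_unitaryGroup_iff.mp (hVm l (x l))) (s, r l))
        (s', r' l)
      rw [Matrix.mul_apply] at h
      simp only [Matrix.star_apply] at h
      simp only [key]
      rw [h, Matrix.one_apply, Matrix.one_apply]
      refine if_congr ?_ rfl rfl
      simp only [Prod.mk.injEq, true_and, and_true]
      refine and_congr_right fun _ => ⟨fun h => ?_, fun h => by rw [h]⟩
      funext i
      by_cases hi : i = l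
      · subst hi; exact h
      · exact (h2 i hi).symm
    · rw [Matrix.one_apply, if_neg]
      · refine Finset.sum_eq_zero fun y _ => ?_
        rw [mul_eq_zero, star_eq_zero]
        right
        by_contra hne
        obtain ⟨s', c', r', f'⟩ := p'
        induction c' using Fin.cases with
        | zero => exact Fin.succ_ne_zero l (Vmat_support P x hne).1
        | succ k =>
          rw [Vmat_succ] at hne
          obtain ⟨⟨h1, h2, h3, h4⟩, -⟩ := ite_ne_right_iff.mp hne
          obtain rfl := Fin.succ_injective _ h1
          refine hc ⟨rfl, fun i hi => ?_, ?_⟩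
          · simpa [hi] using (h2 i hi).symm
          · funext i
            by_cases hi : i = l
            · subst hi; simpa using h4.symm
            · simpa [hi] using (h3 i hi).symm
      · rintro rfl
        exact hc ⟨rfl, fun _ _ => rfl, rfl⟩

lemma tailPhi_mem_unitaryGroup (hVm : P.unitaryVm) (hU : P.unitaryU) :
    ∀ k, k ≤ T → P.tailPhi x k ∈ Matrix.unitaryGroup (Idx N T S A) ℂ
  | 0, _ => one_mem _
  | k + 1, hk => mul_mem (tailPhi_mem_unitaryGroup hVm hU k (by omega))
      (mul_mem (Vmat_mem_unitaryGroup P x hVm)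
        (extSC_mem_unitaryGroup (hU _ (by omega) (by omega))))

/-- On the support of `v`, the flag of lab `l` lies between `1` and `m`. -/
def FlagIn (l : Fin N) (m : ℕ) (v : Idx N T S A → ℂ) : Prop :=
  ∀ p, v p ≠ 0 → 1 ≤ (p.2.2.2 l).val ∧ (p.2.2.2 l).val ≤ m

lemma FlagIn.extSC {l : Fin N} {m : ℕ} {v : Idx N T S A → ℂ} (hv : FlagIn l m v)
    (M : Matrix (S × Fin (N + 1)) (S × Fin (N + 1)) ℂ) :
    FlagIn l m ((CIQ.extSC M).mulVec v) := by
  intro p hp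
  obtain ⟨q, hM, hq⟩ := exists_of_mulVec_ne_zero hp
  rw [extSC_eq_of_ne_zero hM]
  exact hv q hq

lemma val_add_one_of_lt_last {m : ℕ} (a : Fin (T + 1)) (ha : a.val ≤ m) (hm : m + 1 ≤ T) :
    (a + 1).val = a.val + 1 :=
  Fin.val_add_one_of_lt (by rw [Fin.lt_def, Fin.val_last]; omega)

lemma FlagIn.Vmat {l : Fin N} {m : ℕ} {v : Idx N T S A → ℂ} (hv : FlagIn l m v)
    (hm : m + 1 ≤ T) : FlagIn l (m + 1) ((P.Vmat x).mulVec v) := by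
  intro p hp
  obtain ⟨q, hM, hq⟩ := exists_of_mulVec_ne_zero hp
  obtain ⟨-, h1, h2⟩ := Vmat_support P x hM
  obtain ⟨h3, h4⟩ := hv q hq
  by_cases hl : p.2.1 = l.succ
  · rw [← h2 l hl, val_add_one_of_lt_last _ h4 hm]
    omega
  · rw [← h1 l hl]
    omega

lemma FlagIn.two_le_of_Vmat {l : Fin N} {m : ℕ} {v : Idx N T S A → ℂ} (hv : FlagIn l m v)
    (hm : m + 1 ≤ T) {p : Idx N T S A} (hp : (P.Vmat x).mulVec v p ≠ 0)
    (hl : p.2.1 = l.succ) : 2 ≤ (p.2.2.2 l).val := by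
  obtain ⟨q, hM, hq⟩ := exists_of_mulVec_ne_zero hp
  obtain ⟨h3, h4⟩ := hv q hq
  rw [← (Vmat_support P x hM).2.2 l hl, val_add_one_of_lt_last _ h4 hm]
  omega

lemma exists_tailPhi_add_mulVec {l : Fin N} (k : ℕ) :
    ∀ (j m : ℕ) (v : Idx N T S A → ℂ), FlagIn l m v → m + j ≤ T →
      ∃ w, (P.tailPhi x (k + j)).mulVec v = (P.tailPhi x k).mulVec w ∧ FlagIn l (m + j) w
  | 0, _, v, hv, _ => ⟨v, rfl, hv⟩
  | j + 1, m, v, hv, hm => by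
    obtain ⟨w, hw, hF⟩ := exists_tailPhi_add_mulVec k j (m + 1) _
      ((hv.extSC (P.U (T - (k + j)))).Vmat P x (by omega)) (by omega)
    refine ⟨w, ?_, by rwa [← add_assoc, add_right_comm]⟩
    rw [← hw, Matrix.mulVec_mulVec, Matrix.mulVec_mulVec,
      Matrix.mul_assoc]
    rfl

variable [∀ i, Fintype (X i)] [∀ i, DecidableEq (X i)]

lemma phiFull_support {l : Fin N} {a : A l} {t : ℕ} {H : Hist N A X} {p : Idx N T S A}
    (hp : P.phiFull x l a t H p ≠ 0) :
    p.2.1 = l.succ ∧ p.2.2.2 l = 1 ∧ ∀ e ∈ H, p.2.2.2 e.1 = 1 := by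
  obtain ⟨q, hM, hq⟩ := exists_of_mulVec_ne_zero (ite_ne_right_iff.mp hp).2
  obtain ⟨⟨hc, h1, h2⟩, -⟩ := ite_ne_right_iff.mp hq
  obtain ⟨hc', h3, h4⟩ := Vmat_support P x hM
  have hpl : p.2.1 = l.succ := hc'.symm.trans hc
  have hl : p.2.2.2 l = 1 := by
    rw [← h4 l hpl, h2 l (by simp), zero_add]
  refine ⟨hpl, hl, fun e he => ?_⟩
  by_cases hel : e.1 = l
  · rw [hel, hl]
  · rw [← h3 e.1 fun h => hel (Fin.succ_injective _ (hpl.symm.trans h)).symm]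
    exact (h1 e (by simp [he, hel])).2

lemma hinner_phibar_eq_zero_of_lt (hVm : P.unitaryVm) (hU : P.unitaryU) {H : Hist N A X}
    {l l' : Fin N} (a : A l) (a' : A l') (hl : ∃ e ∈ H, e.1 = l)
    {t t' : ℕ} (ht' : 1 ≤ t') (hlt : t' < t) (htT : t ≤ T) :
    hinner (P.phibar x l' a' t' H) (P.phibar x l a t H) = 0 := by
  have h1 : ((1 : Fin (T + 1)) : ℕ) = 1 := by
    rw [Fin.val_one', Nat.mod_eq_of_lt (by omega)]
  have hF : FlagIn l 1 (P.phiFull x l' a' t' H) := by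
    intro p hp
    obtain ⟨e, he, rfl⟩ := hl
    rw [(phiFull_support P x hp).2.2 e he, h1]
    exact ⟨le_rfl, le_rfl⟩
  obtain ⟨w, hw, hFw⟩ := exists_tailPhi_add_mulVec P x (T - t + 1) (t - t' - 1) 1 _ hF (by omega)
  have hk : T - t' = T - t + 1 + (t - t' - 1) := by omega
  have hw' : P.phibar x l' a' t' H = (P.tailPhi x (T - t)).mulVec
      ((P.Vmat x).mulVec ((extSC (P.U (T - (T - t)))).mulVec w)) := by
    rw [phibar, hk, hw, Matrix.mulVec_mulVec, Matrix.mulVec_mulVec,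
      Matrix.mul_assoc]
    rfl
  rw [hw', phibar, hinner_mulVec_of_unitary (tailPhi_mem_unitaryGroup P x hVm hU _ (by omega))]
  refine hinner_eq_zero_of_disjoint fun p hp hp' => ?_
  obtain ⟨hc, hf, -⟩ := phiFull_support P x hp'
  have := (hFw.extSC _).two_le_of_Vmat P x (by omega) hp hc
  rw [hf, h1] at this
  omega

end Aux

end CIQ

/-- **Lemma 2**: for any history `H`, labs `l, l'` whose triples occur in `H`,
and times `t, t' ∈ {1,…,T}`, we have `⟨φ̄_(l',t',H) | φ̄_(l,t,H)⟩ = 0` unless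
`l = l'` and `t = t'`. -/
theorem lemma_two
    (N T : ℕ) (S : Type) [Fintype S] [DecidableEq S]
    (A : Fin N → Type) [∀ i, Fintype (A i)] [∀ i, DecidableEq (A i)]
    (X : Fin N → Type) [∀ i, Fintype (X i)] [∀ i, DecidableEq (X i)]
    (hN : 1 ≤ N) (hT : N ≤ T)
    (P : Protocol N T S A X) (hVm : P.unitaryVm) (hU : P.unitaryU)
    (x : ∀ l, X l) (H : Hist N A X) (hH : labsDistinct H)
    (l l' : Fin N) (a : A l) (xl : X l) (a' : A l') (xl' : X l')
    (hl : (⟨l, (a, xl)⟩ : (i : Fin N) × (A i × X i)) ∈ H)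
    (hl' : (⟨l', (a', xl')⟩ : (i : Fin N) × (A i × X i)) ∈ H)
    (t t' : ℕ) (ht : t ∈ Finset.Icc 1 T) (ht' : t' ∈ Finset.Icc 1 T)
    (hne : ¬ (l = l' ∧ t = t')) :
    hinner (P.phibar x l' a' t' H) (P.phibar x l a t H) = 0 := by
  rw [Finset.mem_Icc] at ht ht'
  rcases lt_trichotomy t' t with h | rfl | h
  · exact hinner_phibar_eq_zero_of_lt P x hVm hU a a' ⟨_, hl, rfl⟩ ht'.1 h ht.2
  · rw [phibar, phibar, hinner_mulVec_of_unitary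
      (tailPhi_mem_unitaryGroup P x hVm hU _ (Nat.sub_le _ _))]
    refine hinner_eq_zero_of_disjoint fun p hp hp' => hne ⟨?_, rfl⟩
    exact Fin.succ_injective _
      ((phiFull_support P x hp').1.symm.trans (phiFull_support P x hp).1)
  · exact hinner_eq_zero_symm
      (hinner_phibar_eq_zero_of_lt P x hVm hU a' a ⟨_, hl', rfl⟩ ht.1 h ht'.2)
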